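/- For every integer k ≥ 0 there exists a constant C > 0 depending only on k such that the following holds: for every C^∞ function u : ℝ² → ℝ with compact support vanishing on the line {y = 0}, and every C^∞ function w : ℝ² → ℝ with u(x,y) = y·w(x,y) for all (x,y), one has Σ_{t+s ≤ k} ∫_{ℝ²} |∂ₓᵗ∂_y^{s} w|² ≤ C · Σ_{t+s ≤ k+1} ∫_{ℝ²} |∂ₓᵗ∂_y^{s} u|², i.e. the full H^k Sobolev norm of w is bounded by C times the full H^{k+1} Sobolev norm of u. -/

import Mathlib

open MeasureTheory

/-- Mixed partial derivative of order `t` in the first variable and order `s` in the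
second variable of a function `f : ℝ × ℝ → ℝ`. -/
noncomputable def mixedPartial (t s : ℕ) (f : ℝ × ℝ → ℝ) : ℝ × ℝ → ℝ :=
  fun p => iteratedDeriv t (fun x => iteratedDeriv s (fun y => f (x, y)) p.2) p.1

/-- The derivative of `f` in the constant direction `v`. -/
noncomputable def dirDeriv (v : ℝ × ℝ) (f : ℝ × ℝ → ℝ) : ℝ × ℝ → ℝ :=
  fun p => fderiv ℝ f p v

theorem ContDiff.dirDeriv {f : ℝ × ℝ → ℝ} (hf : ContDiff ℝ (⊤ : ℕ∞) f) (v : ℝ × ℝ) :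
    ContDiff ℝ (⊤ : ℕ∞) (dirDeriv v f) :=
  (hf.fderiv_right (m := (⊤ : ℕ∞)) (by simp)).clm_apply contDiff_const

theorem ContDiff.iterate_dirDeriv {f : ℝ × ℝ → ℝ} (hf : ContDiff ℝ (⊤ : ℕ∞) f)
    (v : ℝ × ℝ) (n : ℕ) : ContDiff ℝ (⊤ : ℕ∞) ((_root_.dirDeriv v)^[n] f) := by
  induction n with
  | zero => exact hf
  | succ n ih => rw [Function.iterate_succ_apply']; exact ih.dirDeriv v

theorem HasCompactSupport.iterate_dirDeriv {f : ℝ × ℝ → ℝ} (hf : HasCompactSupport f)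
    (v : ℝ × ℝ) (n : ℕ) : HasCompactSupport ((dirDeriv v)^[n] f) := by
  induction n with
  | zero => exact hf
  | succ n ih => rw [Function.iterate_succ_apply']; exact ih.fderiv_apply (𝕜 := ℝ) v

theorem dirDeriv_comm {f : ℝ × ℝ → ℝ} (hf : ContDiff ℝ (⊤ : ℕ∞) f) (v v' : ℝ × ℝ) :
    dirDeriv v (dirDeriv v' f) = dirDeriv v' (dirDeriv v f) := by
  funext p
  have hd : DifferentiableAt ℝ (fderiv ℝ f) p :=
    (hf.fderiv_right (m := (⊤ : ℕ∞)) (by simp)).differentiable (by simp) p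
  have key (a b : ℝ × ℝ) : dirDeriv a (dirDeriv b f) p = fderiv ℝ (fderiv ℝ f) p a b := by
    unfold dirDeriv
    rw [fderiv_clm_apply hd (differentiableAt_const b)]
    simp
  rw [key, key]
  exact (hf.contDiffAt.isSymmSndFDerivAt (by simp only [minSmoothness_of_isRCLikeNormedField]; exact WithTop.coe_le_coe.2 (le_top (a := (2 : ℕ∞))))) v v'

theorem dirDeriv_iterate_comm {f : ℝ × ℝ → ℝ} (hf : ContDiff ℝ (⊤ : ℕ∞) f) (v v' : ℝ × ℝ)
    (n : ℕ) : dirDeriv v ((dirDeriv v')^[n] f) = (dirDeriv v')^[n] (dirDeriv v f) := by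
  induction n with
  | zero => rfl
  | succ n ih =>
    rw [Function.iterate_succ_apply', dirDeriv_comm (hf.iterate_dirDeriv v' n), ih,
      Function.iterate_succ_apply']

theorem hasDerivAt_fst_slice {f : ℝ × ℝ → ℝ} (hf : ContDiff ℝ (⊤ : ℕ∞) f) (x y : ℝ) :
    HasDerivAt (fun x => f (x, y)) (dirDeriv (1, 0) f (x, y)) x :=
  ((hf.differentiable (by simp) (x, y)).hasFDerivAt).comp_hasDerivAt x
    ((hasDerivAt_id x).prodMk (hasDerivAt_const x y))

theorem hasDerivAt_snd_slice {f : ℝ × ℝ → ℝ} (hf : ContDiff ℝ (⊤ : ℕ∞) f) (x y : ℝ) :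
    HasDerivAt (fun y => f (x, y)) (dirDeriv (0, 1) f (x, y)) y :=
  ((hf.differentiable (by simp) (x, y)).hasFDerivAt).comp_hasDerivAt y
    ((hasDerivAt_const y x).prodMk (hasDerivAt_id y))

theorem iteratedDeriv_fst_slice {f : ℝ × ℝ → ℝ} (hf : ContDiff ℝ (⊤ : ℕ∞) f) (n : ℕ) (y : ℝ) :
    iteratedDeriv n (fun x => f (x, y)) = fun x => (dirDeriv (1, 0))^[n] f (x, y) := by
  induction n with
  | zero => simp
  | succ n ih =>
    rw [iteratedDeriv_succ, ih, Function.iterate_succ_apply']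
    exact funext fun x => (hasDerivAt_fst_slice (hf.iterate_dirDeriv _ n) x y).deriv

theorem iteratedDeriv_snd_slice {f : ℝ × ℝ → ℝ} (hf : ContDiff ℝ (⊤ : ℕ∞) f) (n : ℕ) (x : ℝ) :
    iteratedDeriv n (fun y => f (x, y)) = fun y => (dirDeriv (0, 1))^[n] f (x, y) := by
  induction n with
  | zero => simp
  | succ n ih =>
    rw [iteratedDeriv_succ, ih, Function.iterate_succ_apply']
    exact funext fun y => (hasDerivAt_snd_slice (hf.iterate_dirDeriv _ n) x y).deriv

theorem mixedPartial_eq_iterate_dirDeriv {f : ℝ × ℝ → ℝ} (hf : ContDiff ℝ (⊤ : ℕ∞) f)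
    (t s : ℕ) : mixedPartial t s f = (dirDeriv (1, 0))^[t] ((dirDeriv (0, 1))^[s] f) := by
  funext ⟨x, y⟩
  simp only [mixedPartial, iteratedDeriv_snd_slice hf]
  rw [iteratedDeriv_fst_slice (hf.iterate_dirDeriv _ s)]

theorem contDiff_mixedPartial {f : ℝ × ℝ → ℝ} (hf : ContDiff ℝ (⊤ : ℕ∞) f) (t s : ℕ) :
    ContDiff ℝ (⊤ : ℕ∞) (mixedPartial t s f) := by
  rw [mixedPartial_eq_iterate_dirDeriv hf]
  exact (hf.iterate_dirDeriv _ s).iterate_dirDeriv _ t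

theorem hasCompactSupport_mixedPartial {f : ℝ × ℝ → ℝ} (hf : ContDiff ℝ (⊤ : ℕ∞) f)
    (hc : HasCompactSupport f) (t s : ℕ) : HasCompactSupport (mixedPartial t s f) := by
  rw [mixedPartial_eq_iterate_dirDeriv hf]
  exact (hc.iterate_dirDeriv _ s).iterate_dirDeriv _ t

theorem hasDerivAt_mixedPartial_snd {f : ℝ × ℝ → ℝ} (hf : ContDiff ℝ (⊤ : ℕ∞) f) (t s : ℕ)
    (x y : ℝ) :
    HasDerivAt (fun y => mixedPartial t s f (x, y)) (mixedPartial t (s + 1) f (x, y)) y := by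
  have h := hasDerivAt_snd_slice (contDiff_mixedPartial hf t s) x y
  rwa [mixedPartial_eq_iterate_dirDeriv hf,
    dirDeriv_iterate_comm (hf.iterate_dirDeriv _ s), ← Function.iterate_succ_apply' (dirDeriv (0, 1)),
    ← mixedPartial_eq_iterate_dirDeriv hf, ← mixedPartial_eq_iterate_dirDeriv hf] at h

/-- Leibniz rule for the mixed partial derivatives of `y * w`. -/
theorem mixedPartial_succ_snd_mul {u w : ℝ × ℝ → ℝ} (hw : ContDiff ℝ (⊤ : ℕ∞) w)
    (huw : ∀ x y : ℝ, u (x, y) = y * w (x, y)) (t s : ℕ) (x y : ℝ) :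
    mixedPartial t (s + 1) u (x, y) =
      y * mixedPartial t (s + 1) w (x, y) + (s + 1) * mixedPartial t s w (x, y) := by
  have hslice : ∀ x : ℝ, iteratedDeriv (s + 1) (fun y => u (x, y)) = fun y =>
      y * (dirDeriv (0, 1))^[s + 1] w (x, y) + (s + 1) * (dirDeriv (0, 1))^[s] w (x, y) := by
    intro x
    have hd (n : ℕ) (y : ℝ) := hasDerivAt_snd_slice (hw.iterate_dirDeriv (0, 1) n) x y
    simp only [← Function.iterate_succ_apply' (dirDeriv (0, 1))] at hd
    simp only [huw]
    induction s with
    | zero =>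
      funext y
      rw [zero_add, iteratedDeriv_one]
      refine (((hasDerivAt_id y).mul (hd 0 y)).congr_deriv ?_).deriv
      simp only [id, Function.iterate_zero]
      push_cast
      ring
    | succ s ih =>
      rw [iteratedDeriv_succ, ih]
      funext y
      refine ((((hasDerivAt_id y).mul (hd (s + 1) y)).add
        ((hd s y).const_mul ((s : ℝ) + 1))).congr_deriv ?_).deriv
      push_cast
      simp only [id]
      ring
  have h1 (n : ℕ) := (hw.iterate_dirDeriv (0, 1) n).comp
    (contDiff_id.prodMk contDiff_const : ContDiff ℝ (⊤ : ℕ∞) fun x : ℝ => (x, y))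
  have h2 (n : ℕ) : ContDiffAt ℝ t (fun x => (dirDeriv (0, 1))^[n] w (x, y)) x :=
    ((h1 n).of_le (by exact_mod_cast le_top)).contDiffAt
  simp only [mixedPartial, hslice, iteratedDeriv_snd_slice hw]
  rw [iteratedDeriv_fun_add (contDiffAt_const.mul (h2 _)) (contDiffAt_const.mul (h2 _)),
    iteratedDeriv_const_mul_field, iteratedDeriv_const_mul_field]

/-- If `y * w` has compact support and `w` is continuous, then `w` has compact support. -/
theorem hasCompactSupport_of_snd_mul {u w : ℝ × ℝ → ℝ} (hu : HasCompactSupport u)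
    (hw : Continuous w) (huw : ∀ x y : ℝ, u (x, y) = y * w (x, y)) : HasCompactSupport w := by
  refine hu.mono' ?_
  have hd : Dense (Prod.snd ⁻¹' ({0}ᶜ : Set ℝ) : Set (ℝ × ℝ)) :=
    (dense_compl_singleton (0 : ℝ)).preimage isOpenMap_snd
  refine (hd.open_subset_closure_inter hw.isOpen_support).trans (closure_mono ?_)
  rintro ⟨x, y⟩ ⟨hw0, hy⟩
  rw [Function.mem_support, huw]
  exact mul_ne_zero hy hw0

theorem integral_deriv_snd_eq_zero {f f' : ℝ × ℝ → ℝ} (hf : HasCompactSupport f)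
    (hf' : Continuous f') (hd : ∀ x y : ℝ, HasDerivAt (fun y => f (x, y)) (f' (x, y)) y)
    (hc' : HasCompactSupport f') : ∫ p, f' p = 0 := by
  have hi : Integrable f' := hf'.integrable_of_hasCompactSupport hc'
  rw [Measure.volume_eq_prod] at hi ⊢
  rw [integral_prod _ hi]
  refine integral_eq_zero_of_ae (Filter.Eventually.of_forall fun x => ?_)
  have hemb : Topology.IsClosedEmbedding fun y : ℝ => (x, y) :=
    Topology.IsClosedEmbedding.of_continuous_injective_isClosedMap (by fun_prop)
      (Prod.mk_right_injective x) (isClosedMap_prodMk_left x)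
  have hs : HasCompactSupport fun y => f (x, y) := hf.comp_isClosedEmbedding hemb
  have hs' : HasCompactSupport fun y => f' (x, y) := hc'.comp_isClosedEmbedding hemb
  have hc : Continuous fun y => f (x, y) :=
    continuous_iff_continuousAt.2 fun y => (hd x y).continuousAt
  exact integral_eq_zero_of_hasDerivAt_of_integrable (hd x)
    ((hf'.comp hemb.continuous).integrable_of_hasCompactSupport hs')
    (hc.integrable_of_hasCompactSupport hs)

/-- One-dimensional Hardy-type inequality integrated over the plane: `v` is controlled by
`y * ∂_y v + c * v` for `c ≥ 1`. -/
theorem integral_sq_le_of_hasDerivAt_snd {v v' G : ℝ × ℝ → ℝ} {c : ℝ} (hc : 1 ≤ c)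
    (vc : Continuous v) (vs : HasCompactSupport v) (Gc : Continuous G) (Gs : HasCompactSupport G)
    (hd : ∀ x y : ℝ, HasDerivAt (fun y => v (x, y)) (v' (x, y)) y)
    (hG : ∀ x y : ℝ, G (x, y) = y * v' (x, y) + c * v (x, y)) :
    ∫ p, v p ^ 2 ≤ 4 * ∫ p, G p ^ 2 := by
  have vs2 : HasCompactSupport fun p => v p ^ 2 := vs.comp_left (g := fun r => r ^ 2) (by simp)
  have Gs2 : HasCompactSupport fun p => G p ^ 2 := Gs.comp_left (g := fun r => r ^ 2) (by simp)
  have hvi : Integrable fun p => v p ^ 2 := (vc.pow 2).integrable_of_hasCompactSupport vs2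
  have hGi : Integrable fun p => G p ^ 2 := (Gc.pow 2).integrable_of_hasCompactSupport Gs2
  let F : ℝ × ℝ → ℝ := fun p => v p * (2 * G p - (2 * c - 1) * v p)
  have Fc : Continuous F := by fun_prop
  have Fs : HasCompactSupport F := vs.mul_right
  have hFi : Integrable F := Fc.integrable_of_hasCompactSupport Fs
  have hF : ∫ p, F p = 0 := by
    have hs : HasCompactSupport fun p : ℝ × ℝ => p.2 * v p ^ 2 :=
      vs2.mul_left (f := fun p : ℝ × ℝ => p.2)
    refine integral_deriv_snd_eq_zero hs Fc (fun x y => ?_) Fs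
    refine ((hasDerivAt_id y).mul ((hd x y).pow 2)).congr_deriv ?_
    simp only [F, hG, id, Pi.pow_apply]
    norm_num
    ring
  have hle : ∫ p, v p ^ 2 ≤ ∫ p, (4 * G p ^ 2 - 2 * F p) := by
    refine integral_mono hvi ((hGi.const_mul 4).sub (hFi.const_mul 2)) fun p => ?_
    have hs : 0 ≤ (c - 1) * v p ^ 2 := mul_nonneg (sub_nonneg.2 hc) (sq_nonneg _)
    simp only [F]
    nlinarith [sq_nonneg (2 * G p - v p)]
  rw [integral_sub (hGi.const_mul 4) (hFi.const_mul 2),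
    integral_const_mul, integral_const_mul, hF] at hle
  linarith

/-- Hardy-type inequality for a single mixed partial derivative. -/
theorem integral_mixedPartial_sq_le {u w : ℝ × ℝ → ℝ} (hu : ContDiff ℝ (⊤ : ℕ∞) u)
    (huc : HasCompactSupport u) (hw : ContDiff ℝ (⊤ : ℕ∞) w)
    (huw : ∀ x y : ℝ, u (x, y) = y * w (x, y)) (t s : ℕ) :
    ∫ p : ℝ × ℝ, (mixedPartial t s w p) ^ 2 ≤
      4 * ∫ p : ℝ × ℝ, (mixedPartial t (s + 1) u p) ^ 2 :=
  integral_sq_le_of_hasDerivAt_snd (c := s + 1) (by simp)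
    (contDiff_mixedPartial hw t s).continuous
    (hasCompactSupport_mixedPartial hw (hasCompactSupport_of_snd_mul huc hw.continuous huw) t s)
    (contDiff_mixedPartial hu t (s + 1)).continuous
    (hasCompactSupport_mixedPartial hu huc t (s + 1))
    (hasDerivAt_mixedPartial_snd hw t s) (mixedPartial_succ_snd_mul hw huw t s)

/-- for every `k` there is `C > 0` (depending only on `k`) such that for all
smooth compactly supported `u` vanishing on `{y = 0}` and smooth `w` with `u = y·w`,
the full `H^k` norm (squared) of `w`, i.e. the sum over all pairs `(t,s)` with
`t + s ≤ k` of `‖∂ₓᵗ∂_y^s w‖²_{L²(ℝ²)}`, is bounded by `C` times the full `H^{k+1}`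
norm (squared) of `u`. -/
theorem stmt7 (k : ℕ) :
    ∃ C : ℝ, 0 < C ∧
      ∀ (u w : ℝ × ℝ → ℝ), ContDiff ℝ (⊤ : ℕ∞) u → HasCompactSupport u →
        (∀ x : ℝ, u (x, 0) = 0) → ContDiff ℝ (⊤ : ℕ∞) w →
        (∀ x y : ℝ, u (x, y) = y * w (x, y)) →
        ∑ t ∈ Finset.range (k + 1), ∑ s ∈ Finset.range (k + 1 - t),
            ∫ p : ℝ × ℝ, (mixedPartial t s w p) ^ 2 ≤
          C * ∑ t ∈ Finset.range (k + 2), ∑ s ∈ Finset.range (k + 2 - t),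
            ∫ p : ℝ × ℝ, (mixedPartial t s u p) ^ 2 := by
  refine ⟨4, by norm_num, fun u w hu huc _ hw huw => ?_⟩
  have hnn (t s : ℕ) : 0 ≤ ∫ p : ℝ × ℝ, (mixedPartial t s u p) ^ 2 :=
    integral_nonneg fun p => sq_nonneg _
  rw [Finset.sum_range_succ _ (k + 1), mul_add, Finset.mul_sum]
  refine le_add_of_le_of_nonneg (Finset.sum_le_sum fun t ht => ?_)
    (mul_nonneg (by norm_num) (Finset.sum_nonneg fun s _ => hnn _ s))
  have hk : k + 2 - t = k + 1 - t + 1 := by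
    have := Finset.mem_range.1 ht
    omega
  rw [hk, Finset.sum_range_succ', mul_add, Finset.mul_sum]
  exact le_add_of_le_of_nonneg
    (Finset.sum_le_sum fun s _ => integral_mixedPartial_sq_le hu huc hw huw t s)
    (mul_nonneg (by norm_num) (hnn t 0))
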